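/- If 𝐦 ∈ 𝐍𝐑, then |𝐦·λ| < m. -/

import Mathlib

open scoped BigOperators

/-- The dot product 𝐦·λ = Σⱼ (m₊ⱼ − m₋ⱼ)λⱼ. -/
def mdot {N : ℕ} (lam : Fin N → ℝ) (m : (Fin N → ℕ) × (Fin N → ℕ)) : ℝ :=
  ∑ j, ((m.1 j : ℝ) - (m.2 j : ℝ)) * lam j

/-- The norm ‖𝐦‖ = Σⱼ (m₊ⱼ + m₋ⱼ). -/
def mnorm {N : ℕ} (m : (Fin N → ℕ) × (Fin N → ℕ)) : ℕ :=
  ∑ j, (m.1 j + m.2 j)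

/-- The relation 𝐧 ≺ 𝐦. -/
def prec {N : ℕ} (n m : (Fin N → ℕ) × (Fin N → ℕ)) : Prop :=
  (∀ j, n.1 j + n.2 j ≤ m.1 j + m.2 j) ∧ mnorm n < mnorm m

/-- The resonant set 𝐑 = {𝐦 : |𝐦·λ| > m}. -/
def Rset {N : ℕ} (lam : Fin N → ℝ) (mass : ℝ) : Set ((Fin N → ℕ) × (Fin N → ℕ)) :=
  {m | |mdot lam m| > mass}

/-- The minimal resonant set 𝐑_min. -/
def Rmin {N : ℕ} (lam : Fin N → ℝ) (mass : ℝ) : Set ((Fin N → ℕ) × (Fin N → ℕ)) :=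
  {m | m ∈ Rset lam mass ∧ ∀ n ∈ Rset lam mass, ¬ prec n m}

/-- The set 𝐈 = {𝐦 : ∃ 𝐧 ∈ 𝐑_min, 𝐧 ≺ 𝐦}. -/
def Iset {N : ℕ} (lam : Fin N → ℝ) (mass : ℝ) : Set ((Fin N → ℕ) × (Fin N → ℕ)) :=
  {m | ∃ n ∈ Rmin lam mass, prec n m}

/-- The non-resonant set 𝐍𝐑 = ℕ₀^{2N} ∖ (𝐑_min ∪ 𝐈). -/
def NRset {N : ℕ} (lam : Fin N → ℝ) (mass : ℝ) : Set ((Fin N → ℕ) × (Fin N → ℕ)) :=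
  (Rmin lam mass ∪ Iset lam mass)ᶜ

theorem prec_trans_aux {N : ℕ} {a b c : (Fin N → ℕ) × (Fin N → ℕ)} (h1 : prec a b)
    (h2 : prec b c) : prec a c :=
  ⟨fun j => (h1.1 j).trans (h2.1 j), h1.2.trans h2.2⟩

theorem mem_Rmin_or_Iset {N : ℕ} (lam : Fin N → ℝ) (mass : ℝ) (k : ℕ) :
    ∀ n : (Fin N → ℕ) × (Fin N → ℕ), mnorm n = k → n ∈ Rset lam mass →
      n ∈ Rmin lam mass ∨ n ∈ Iset lam mass := by
  induction k using Nat.strong_induction_on with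
  | _ k ih =>
    intro n hk hn
    by_cases h : ∃ p ∈ Rset lam mass, prec p n
    · obtain ⟨p, hp, hpn⟩ := h
      right
      rcases ih (mnorm p) (hk ▸ hpn.2) p rfl hp with h1 | ⟨q, hq, hqp⟩
      · exact ⟨p, h1, hpn⟩
      · exact ⟨q, hq, prec_trans_aux hqp hpn⟩
    · left
      exact ⟨hn, fun p hp hpn => h ⟨p, hp, hpn⟩⟩

theorem mul_mnorm_le_mdot {N : ℕ} (lam : Fin N → ℝ) (c : ℝ) (hc : ∀ j, c ≤ lam j)
    (f : Fin N → ℕ) : (mnorm (f, (0 : Fin N → ℕ)) : ℝ) * c ≤ mdot lam (f, 0) := by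
  simp only [mnorm, mdot, Pi.zero_apply, add_zero, Nat.cast_zero, sub_zero, Nat.cast_sum,
    Finset.sum_mul]
  exact Finset.sum_le_sum fun j _ => mul_le_mul_of_nonneg_left (hc j) (Nat.cast_nonneg _)

/-- If 𝐦 ∈ 𝐍𝐑, then |𝐦·λ| < m. -/
theorem abs_mdot_lt_of_mem_NR {N : ℕ} (hN : 0 < N) (lam : Fin N → ℝ) (mass : ℝ)
    (hmass : 0 < mass)
    (hpos : ∀ j, 0 < lam j)
    (hmono : StrictMono lam)
    (hlt : ∀ j, lam j < mass)
    (M : ℕ)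
    (hM1 : ((M : ℝ) - 1) * lam ⟨0, hN⟩ < mass)
    (hM2 : mass ≤ (M : ℝ) * lam ⟨0, hN⟩)
    (hgen : ∀ m : (Fin N → ℕ) × (Fin N → ℕ), mnorm m ≤ M → (mdot lam m) ^ 2 ≠ mass ^ 2)
    (m : (Fin N → ℕ) × (Fin N → ℕ)) (hm : m ∈ NRset lam mass) :
    |mdot lam m| < mass := by
  have key : ∀ n, n ∈ Rset lam mass → n ∈ Rmin lam mass ∨ n ∈ Iset lam mass :=
    fun n hn => mem_Rmin_or_Iset lam mass _ n rfl hn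
  by_contra hcon
  rcases lt_or_eq_of_le (not_lt.mp hcon) with hgt | heq
  · exact hm (key m hgt)
  · have hMm : M < mnorm m := by
      by_contra hle
      apply hgen m (not_lt.mp hle)
      rw [heq, sq_abs]
    have hl0 := hpos ⟨0, hN⟩
    have hc : ∀ j, lam ⟨0, hN⟩ ≤ lam j := fun j => hmono.monotone (Fin.mk_le_of_le_val (Nat.zero_le _))
    have hMs : mass < (M : ℝ) * lam ⟨0, hN⟩ := by
      refine lt_of_le_of_ne hM2 fun h => ?_
      refine hgen (Pi.single ⟨0, hN⟩ M, 0) ?_ ?_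
      · simp [mnorm]
      · rw [h]
        congr 1
        simp only [mdot, Pi.zero_apply, Nat.cast_zero, sub_zero]
        rw [Finset.sum_eq_single ⟨0, hN⟩]
        · simp
        · intro b _ hb
          simp [Pi.single_eq_of_ne hb]
        · simp
    obtain ⟨j, hj⟩ : ∃ j, 0 < m.1 j + m.2 j := by
      by_contra hno
      push Not at hno
      have : mnorm m = 0 := Finset.sum_eq_zero fun j _ => Nat.le_zero.mp (hno j)
      omega
    let f : Fin N → ℕ := fun i => if i = j then m.1 i + m.2 i - 1 else m.1 i + m.2 i
    have hf : mnorm (f, (0 : Fin N → ℕ)) + 1 = mnorm m := by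
      have h1 : ∀ i, m.1 i + m.2 i = f i + (if i = j then 1 else 0) := by
        intro i
        by_cases hi : i = j
        · subst hi
          simp only [f, if_true]
          omega
        · simp [f, hi]
      simp only [mnorm, h1, Finset.sum_add_distrib]
      simp
    have hfR : (f, (0 : Fin N → ℕ)) ∈ Rset lam mass := by
      have h1 := mul_mnorm_le_mdot lam _ hc f
      have h2 : (M : ℝ) ≤ (mnorm (f, (0 : Fin N → ℕ)) : ℝ) := by
        exact_mod_cast (by omega : M ≤ mnorm (f, (0 : Fin N → ℕ)))
      have h3 := mul_le_mul_of_nonneg_right h2 hl0.le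
      exact lt_of_lt_of_le (by linarith) (le_abs_self (mdot lam (f, 0)))
    have hfm : prec (f, (0 : Fin N → ℕ)) m := by
      refine ⟨fun i => ?_, by omega⟩
      simp only [f, Pi.zero_apply]
      split_ifs <;> omega
    apply hm
    right
    rcases key _ hfR with h1 | ⟨q, hq, hqf⟩
    · exact ⟨_, h1, hfm⟩
    · exact ⟨q, hq, prec_trans_aux hqf hfm⟩
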